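/- For every perfect secret sharing scheme Σ for the access structure V6 = Γ_{v6} induced by the Vamos matroid with dealer v6, the information rate satisfies ρ(Σ) ≤ 17/19; consequently ρ(V6) ≤ 17/19. -/

import Mathlib

open MeasureTheory Finset

/-- Shannon entropy of a random variable with values in a finite type:
`H(f) = ∑ₐ −P(f = a)·log P(f = a)`. -/
noncomputable def shannonEntropy {Ω : Type} [MeasurableSpace Ω] {α : Type} [Fintype α]
    (μ : Measure Ω) (f : Ω → α) : ℝ :=
  ∑ a : α, Real.negMulLog ((μ (f ⁻¹' {a})).toReal)

/-- A family of random variables on a common probability space: one (finite-valued)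
random variable `secret` for the secret, and one random variable `share p` for the
share of each participant `p`. -/
structure Scheme (P : Type) [Fintype P] [DecidableEq P] where
  (Ω : Type)
  [mΩ : MeasurableSpace Ω]
  (μ : Measure Ω)
  [prob : IsProbabilityMeasure μ]
  (SecT : Type)
  [secFin : Fintype SecT]
  (ShT : P → Type)
  [shFin : ∀ p, Fintype (ShT p)]
  (secret : Ω → SecT)
  (share : (p : P) → Ω → ShT p)
  (secret_meas : ∀ s : Set SecT, MeasurableSet (secret ⁻¹' s))
  (share_meas : ∀ p, ∀ s : Set (ShT p), MeasurableSet (share p ⁻¹' s))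

namespace Scheme

variable {P : Type} [Fintype P] [DecidableEq P]

/-- `H(S)`: the entropy of the secret. -/
noncomputable def Hsec (S : Scheme P) : ℝ :=
  letI := S.mΩ; letI := S.secFin
  shannonEntropy S.μ S.secret

/-- `H(X)`: the joint entropy of the shares of the participants in `X`. -/
noncomputable def Hset (S : Scheme P) (X : Finset P) : ℝ :=
  letI := S.mΩ; letI := S.shFin
  shannonEntropy S.μ (fun ω => fun p : {y // y ∈ X} => S.share p.1 ω)

/-- `H(X ∪ {S})`: the joint entropy of the shares of the participants in `X`
together with the secret. -/
noncomputable def HsetS (S : Scheme P) (X : Finset P) : ℝ :=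
  letI := S.mΩ; letI := S.secFin; letI := S.shFin
  shannonEntropy S.μ (fun ω => ((fun p : {y // y ∈ X} => S.share p.1 ω), S.secret ω))

/-- The normalized entropy `h(X) = H(X)/H(S)`. -/
noncomputable def hset (S : Scheme P) (X : Finset P) : ℝ := S.Hset X / S.Hsec

/-- The conditional normalized entropy `h(X|Y) = h(X ∪ Y) − h(Y)`. -/
noncomputable def hcond (S : Scheme P) (X Y : Finset P) : ℝ :=
  S.hset (X ∪ Y) - S.hset Y

/-- `Σ` is a perfect secret sharing scheme for the access structure `Γ`:
the conditional entropy `H(S|X) = H(X ∪ {S}) − H(X)` equals `0` for every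
qualified set `X` and equals `H(S)` for every unqualified set `X`. -/
def IsPerfect (S : Scheme P) (Γ : Finset P → Prop) : Prop :=
  (∀ X : Finset P, Γ X → S.HsetS X - S.Hset X = 0) ∧
  (∀ X : Finset P, ¬ Γ X → S.HsetS X - S.Hset X = S.Hsec)

end Scheme
/-- The four Vamos pairs `A = {v₁,v₂}`, `B = {v₃,v₄}`, `C = {v₅,v₆}`, `D = {v₇,v₈}`,
where participant `vᵢ` is represented by `(i-1 : Fin 8)`. -/
def pairA : Finset (Fin 8) := {0, 1}
def pairB : Finset (Fin 8) := {2, 3}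
def pairC : Finset (Fin 8) := {4, 5}
def pairD : Finset (Fin 8) := {6, 7}

/-- `X` is one of the four Vamos pairs. -/
def IsVamosPair (X : Finset (Fin 8)) : Prop :=
  X = pairA ∨ X = pairB ∨ X = pairC ∨ X = pairD

/-- The dependent sets of the Vamos matroid: the five special four-element sets
`AB`, `AC`, `BC`, `BD`, `CD`, and all sets with at least five elements. -/
def VamosDep (X : Finset (Fin 8)) : Prop :=
  X = pairA ∪ pairB ∨ X = pairA ∪ pairC ∨ X = pairB ∪ pairC ∨
    X = pairB ∪ pairD ∨ X = pairC ∪ pairD ∨ 5 ≤ X.card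

/-- The circuits of the Vamos matroid: minimal dependent sets. -/
def VamosCircuit (X : Finset (Fin 8)) : Prop :=
  VamosDep X ∧ ∀ Y ⊂ X, ¬ VamosDep Y

/-- The access structure `Γₓ` induced by the Vamos matroid with dealer `x`
(the dealer is regarded as a participant who is individually qualified):
a set is qualified iff it contains a minimal qualified set, the minimal
qualified sets being `{x}` and the sets `M ⊆ Q \ {x}` with `M ∪ {x}` a circuit. -/
def VamosQualified (x : Fin 8) (Y : Finset (Fin 8)) : Prop :=
  x ∈ Y ∨ ∃ M ⊆ Y, x ∉ M ∧ VamosCircuit (insert x M)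

/-- `λ = (max₁≤ᵢ≤₈ h({vᵢ})) − 1`. -/
noncomputable def Scheme.lam (S : Scheme (Fin 8)) : ℝ :=
  (Finset.univ.sup' Finset.univ_nonempty fun i : Fin 8 => S.hset {i}) - 1

/-- The information rate `ρ(Σ) = min₁≤ᵢ≤₈ H(S)/H(vᵢ)` of a scheme. -/
noncomputable def Scheme.rho (S : Scheme (Fin 8)) : ℝ :=
  Finset.univ.inf' Finset.univ_nonempty fun i : Fin 8 => S.Hsec / S.Hset {i}


open Classical in
/-- The mass, with respect to the weights `p`, of the class of `ω` under `s`. -/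
noncomputable def classMass {Ω : Type} [Fintype Ω] (p : Ω → ℝ) (s : Setoid Ω) (ω : Ω) : ℝ :=
  ∑ ω', p ω' * if s ω' ω then 1 else 0

/-- The entropy of the partition of a finite weighted set into the classes of `s`. -/
noncomputable def partEntropy {Ω : Type} [Fintype Ω] (p : Ω → ℝ) (s : Setoid Ω) : ℝ :=
  -∑ ω, p ω * Real.log (classMass p s ω)

/-- The mutual information of two partitions. -/
noncomputable def mutualInfo {Ω : Type} [Fintype Ω] (p : Ω → ℝ) (x y : Setoid Ω) : ℝ :=
  partEntropy p x + partEntropy p y - partEntropy p (x ⊓ y)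

/-- The mutual information of `x` and `y` conditional on `z`. -/
noncomputable def condMutualInfo {Ω : Type} [Fintype Ω] (p : Ω → ℝ) (x y z : Setoid Ω) : ℝ :=
  partEntropy p (x ⊓ z) + partEntropy p (y ⊓ z) - partEntropy p (x ⊓ y ⊓ z) - partEntropy p z

section PartEntropy

variable {Ω : Type} [Fintype Ω] {p : Ω → ℝ}

lemma classMass_congr (s : Setoid Ω) {a b : Ω} (h : s a b) :
    classMass p s a = classMass p s b := by
  classical
  unfold classMass
  refine Finset.sum_congr rfl fun ω _ => ?_
  have : s ω a ↔ s ω b := ⟨fun k => s.trans k h, fun k => s.trans k (s.symm h)⟩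
  simp only [this]

lemma classMass_nonneg (hp : ∀ ω, 0 ≤ p ω) (s : Setoid Ω) (ω : Ω) : 0 ≤ classMass p s ω := by
  classical
  refine Finset.sum_nonneg fun a _ => mul_nonneg (hp a) ?_
  split_ifs <;> norm_num

lemma classMass_mono (hp : ∀ ω, 0 ≤ p ω) {s t : Setoid Ω} (h : s ≤ t) (ω : Ω) :
    classMass p s ω ≤ classMass p t ω := by
  classical
  refine Finset.sum_le_sum fun a _ => mul_le_mul_of_nonneg_left ?_ (hp a)
  by_cases hs : s a ω
  · simp [hs, h hs]
  · simp only [hs, if_false]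
    split_ifs <;> norm_num

lemma le_classMass (hp : ∀ ω, 0 ≤ p ω) (s : Setoid Ω) (ω : Ω) : p ω ≤ classMass p s ω := by
  classical
  have := Finset.single_le_sum (s := Finset.univ) (f := fun a => p a * if s a ω then 1 else 0)
    (fun a _ => mul_nonneg (hp a) (by split_ifs <;> norm_num)) (Finset.mem_univ ω)
  simpa [classMass, s.refl ω] using this

lemma classMass_pos (hp : ∀ ω, 0 ≤ p ω) (s : Setoid Ω) {ω : Ω} (h : 0 < p ω) :
    0 < classMass p s ω :=
  h.trans_le (le_classMass hp s ω)

lemma partEntropy_mono (hp : ∀ ω, 0 ≤ p ω) {s t : Setoid Ω} (h : s ≤ t) :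
    partEntropy p t ≤ partEntropy p s := by
  refine neg_le_neg (Finset.sum_le_sum fun ω _ => ?_)
  rcases (hp ω).eq_or_lt with h0 | h0
  · simp [← h0]
  · exact mul_le_mul_of_nonneg_left
      (Real.log_le_log (classMass_pos hp s h0) (classMass_mono hp h ω)) (hp ω)

lemma partEntropy_top (h1 : ∑ ω, p ω = 1) : partEntropy p (⊤ : Setoid Ω) = 0 := by
  simp [partEntropy, classMass, h1]

lemma sum_pair_div_classMass_le (hp : ∀ ω, 0 ≤ p ω) (x y z : Setoid Ω) :
    ∑ ω, p ω * (classMass p (x ⊓ z) ω * classMass p (y ⊓ z) ω /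
      (classMass p (x ⊓ y ⊓ z) ω * classMass p z ω)) ≤ ∑ ω, p ω := by
  classical
  have key : ∀ a b : Ω, ∑ ω, p ω * ((if (x ⊓ z) a ω then 1 else 0) *
      (if (y ⊓ z) b ω then 1 else 0) / (classMass p (x ⊓ y ⊓ z) ω * classMass p z ω)) ≤
      (if z b a then 1 else 0) / classMass p z a := by
    intro a b
    by_cases h : ∃ c, (x ⊓ z) a c ∧ (y ⊓ z) b c
    · obtain ⟨c, hac, hbc⟩ := h
      have hz : z b a := z.trans hbc.2 (z.symm hac.2)
      have hterm : ∀ ω, p ω * ((if (x ⊓ z) a ω then (1 : ℝ) else 0) *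
          (if (y ⊓ z) b ω then 1 else 0) / (classMass p (x ⊓ y ⊓ z) ω * classMass p z ω)) =
          (p ω * if (x ⊓ y ⊓ z) ω c then 1 else 0) *
            (1 / (classMass p (x ⊓ y ⊓ z) c * classMass p z a)) := by
        intro ω
        have hiff : (x ⊓ y ⊓ z) ω c ↔ (x ⊓ z) a ω ∧ (y ⊓ z) b ω := by
          constructor
          · rintro ⟨⟨k1, k2⟩, k3⟩
            exact ⟨⟨x.trans hac.1 (x.symm k1), z.trans hac.2 (z.symm k3)⟩,
              ⟨y.trans hbc.1 (y.symm k2), z.trans hbc.2 (z.symm k3)⟩⟩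
          · rintro ⟨⟨k1, k2⟩, k3, -⟩
            exact ⟨⟨x.trans (x.symm k1) hac.1, y.trans (y.symm k3) hbc.1⟩,
              z.trans (z.symm k2) hac.2⟩
        by_cases hω : (x ⊓ y ⊓ z) ω c
        · obtain ⟨k1, k2⟩ := hiff.1 hω
          rw [if_pos hω, if_pos k1, if_pos k2, classMass_congr _ hω,
            classMass_congr z (z.symm k1.2)]
          ring
        · rw [if_neg hω]
          by_cases k1 : (x ⊓ z) a ω
          · rw [if_neg fun k2 => hω (hiff.2 ⟨k1, k2⟩)]
            simp
          · rw [if_neg k1]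
            simp
      rw [Finset.sum_congr rfl fun ω _ => hterm ω, ← Finset.sum_mul, if_pos hz]
      change classMass p (x ⊓ y ⊓ z) c * _ ≤ _
      rcases eq_or_ne (classMass p (x ⊓ y ⊓ z) c) 0 with h0 | h0
      · rw [h0, zero_mul]
        exact div_nonneg zero_le_one (classMass_nonneg hp z a)
      · rw [one_div, mul_inv, mul_inv_cancel_left₀ h0, one_div]
    · rw [Finset.sum_eq_zero]
      · exact div_nonneg (by split_ifs <;> norm_num) (classMass_nonneg hp z a)
      · intro ω _
        by_cases k1 : (x ⊓ z) a ω
        · rw [if_neg fun k2 => h ⟨ω, k1, k2⟩]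
          simp
        · rw [if_neg k1]
          simp
  calc ∑ ω, p ω * (classMass p (x ⊓ z) ω * classMass p (y ⊓ z) ω /
        (classMass p (x ⊓ y ⊓ z) ω * classMass p z ω))
      = ∑ ω, ∑ a, ∑ b, p a * (p b * (p ω * ((if (x ⊓ z) a ω then 1 else 0) *
          (if (y ⊓ z) b ω then 1 else 0) /
          (classMass p (x ⊓ y ⊓ z) ω * classMass p z ω)))) := by
        refine Finset.sum_congr rfl fun ω _ => ?_
        rw [show classMass p (x ⊓ z) ω * classMass p (y ⊓ z) ω = _ from
          Finset.sum_mul_sum _ _ _ _, Finset.sum_div, Finset.mul_sum]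
        refine Finset.sum_congr rfl fun a _ => ?_
        rw [Finset.sum_div, Finset.mul_sum]
        refine Finset.sum_congr rfl fun b _ => ?_
        ring
    _ = ∑ a, ∑ b, p a * (p b * ∑ ω, p ω * ((if (x ⊓ z) a ω then 1 else 0) *
          (if (y ⊓ z) b ω then 1 else 0) /
          (classMass p (x ⊓ y ⊓ z) ω * classMass p z ω))) := by
        rw [Finset.sum_comm]
        refine Finset.sum_congr rfl fun a _ => ?_
        rw [Finset.sum_comm]
        refine Finset.sum_congr rfl fun b _ => ?_
        rw [Finset.mul_sum, Finset.mul_sum]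
    _ ≤ ∑ a, ∑ b, p a * (p b * ((if z b a then 1 else 0) / classMass p z a)) :=
        Finset.sum_le_sum fun a _ => Finset.sum_le_sum fun b _ =>
          mul_le_mul_of_nonneg_left (mul_le_mul_of_nonneg_left (key a b) (hp b)) (hp a)
    _ = ∑ a, p a * (classMass p z a / classMass p z a) := by
        refine Finset.sum_congr rfl fun a _ => ?_
        rw [← Finset.mul_sum]
        congr 1
        conv_rhs => rw [classMass, Finset.sum_div]
        exact Finset.sum_congr rfl fun b _ => by rw [mul_div_assoc]; rfl
    _ ≤ ∑ a, p a :=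
        Finset.sum_le_sum fun a _ => mul_le_of_le_one_right (hp a) (div_self_le_one _)

lemma condMutualInfo_nonneg (hp : ∀ ω, 0 ≤ p ω) (x y z : Setoid Ω) :
    0 ≤ condMutualInfo p x y z := by
  have hterm : ∀ ω, p ω * (Real.log (classMass p (x ⊓ z) ω) + Real.log (classMass p (y ⊓ z) ω) -
      Real.log (classMass p (x ⊓ y ⊓ z) ω) - Real.log (classMass p z ω)) ≤
      p ω * (classMass p (x ⊓ z) ω * classMass p (y ⊓ z) ω /
        (classMass p (x ⊓ y ⊓ z) ω * classMass p z ω)) - p ω := by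
    intro ω
    rcases (hp ω).eq_or_lt with h0 | h0
    · simp [← h0]
    have h1 := classMass_pos hp (x ⊓ z) h0
    have h2 := classMass_pos hp (y ⊓ z) h0
    have h3 := classMass_pos hp (x ⊓ y ⊓ z) h0
    have h4 := classMass_pos hp z h0
    have := Real.log_le_sub_one_of_pos (div_pos (mul_pos h1 h2) (mul_pos h3 h4))
    rw [Real.log_div (mul_pos h1 h2).ne' (mul_pos h3 h4).ne', Real.log_mul h1.ne' h2.ne',
      Real.log_mul h3.ne' h4.ne'] at this
    nlinarith
  have hsum := Finset.sum_le_sum fun ω (_ : ω ∈ Finset.univ) => hterm ω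
  have hle := sum_pair_div_classMass_le hp x y z
  simp only [mul_sub, mul_add, Finset.sum_sub_distrib, Finset.sum_add_distrib] at hsum
  unfold condMutualInfo partEntropy
  linarith

lemma mutualInfo_nonneg (hp : ∀ ω, 0 ≤ p ω) (h1 : ∑ ω, p ω = 1) (x y : Setoid Ω) :
    0 ≤ mutualInfo p x y := by
  have := condMutualInfo_nonneg hp x y ⊤
  simpa [condMutualInfo, mutualInfo, partEntropy_top h1] using this

lemma partEntropy_comap {Ω' : Type} [Fintype Ω'] {q : Ω' → ℝ} {φ : Ω' → Ω}
    (h : ∀ F : Ω → ℝ, ∑ ω, q ω * F (φ ω) = ∑ ω, p ω * F ω) (s : Setoid Ω) :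
    partEntropy q (s.comap φ) = partEntropy p s := by
  classical
  have hm : ∀ ω, classMass q (s.comap φ) ω = classMass p s (φ ω) := fun ω =>
    h fun ω' => if s ω' (φ ω) then 1 else 0
  simp only [partEntropy, hm]
  rw [h fun ω => Real.log (classMass p s ω)]

end PartEntropy

/-- The fibre product of `Ω` with itself over the classes of `Y`. -/
def FibreProd {Ω : Type} (Y : Setoid Ω) : Type := {z : Ω × Ω // Y z.1 z.2}

noncomputable instance {Ω : Type} [Fintype Ω] (Y : Setoid Ω) : Fintype (FibreProd Y) := by
  classical
  exact Subtype.fintype _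

/-- The weights on the fibre product making the two projections independent given `Y`. -/
noncomputable def fibreWeight {Ω : Type} [Fintype Ω] (p : Ω → ℝ) (Y : Setoid Ω)
    (z : FibreProd Y) : ℝ :=
  p z.1.1 * p z.1.2 / classMass p Y z.1.1

section Copy

variable {Ω : Type} [Fintype Ω] {p : Ω → ℝ}

open Classical in
lemma sum_fibreWeight (Y : Setoid Ω) (F : Ω × Ω → ℝ) :
    ∑ z : FibreProd Y, fibreWeight p Y z * F z.1 =
      ∑ a, ∑ b, p a * (p b * if Y b a then 1 else 0) / classMass p Y a * F (a, b) := by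
  rw [← Fintype.sum_prod_type'
    (f := fun a b => p a * (p b * if Y b a then 1 else 0) / classMass p Y a * F (a, b))]
  change ∑ z : {z : Ω × Ω // Y z.1 z.2}, p z.1.1 * p z.1.2 / classMass p Y z.1.1 * F z.1 = _
  rw [← Finset.sum_subtype (Finset.univ.filter fun z : Ω × Ω => Y z.1 z.2) (by simp)
    (fun z : Ω × Ω => p z.1 * p z.2 / classMass p Y z.1 * F z), Finset.sum_filter]
  refine Finset.sum_congr rfl fun z _ => ?_
  by_cases h : Y z.1 z.2
  · simp [h, Y.symm h]
  · have : ¬ Y z.2 z.1 := fun k => h (Y.symm k)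
    simp [h, this]

lemma mul_classMass_div_self (hp : ∀ ω, 0 ≤ p ω) (Y : Setoid Ω) (a : Ω) :
    p a * classMass p Y a / classMass p Y a = p a := by
  rcases (hp a).eq_or_lt with h | h
  · simp [← h]
  · exact mul_div_cancel_right₀ _ (classMass_pos hp Y h).ne'

lemma sum_fibreWeight_fst (hp : ∀ ω, 0 ≤ p ω) (Y : Setoid Ω) (F : Ω → ℝ) :
    ∑ z : FibreProd Y, fibreWeight p Y z * F z.1.1 = ∑ ω, p ω * F ω := by
  classical
  rw [sum_fibreWeight Y fun z => F z.1]
  refine Finset.sum_congr rfl fun a _ => ?_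
  dsimp only
  rw [← Finset.sum_mul, ← Finset.sum_div, ← Finset.mul_sum]
  change p a * classMass p Y a / _ * _ = _
  rw [mul_classMass_div_self hp]

lemma sum_fibreWeight_snd (hp : ∀ ω, 0 ≤ p ω) (Y : Setoid Ω) (F : Ω → ℝ) :
    ∑ z : FibreProd Y, fibreWeight p Y z * F z.1.2 = ∑ ω, p ω * F ω := by
  classical
  rw [sum_fibreWeight Y fun z => F z.2, Finset.sum_comm]
  refine Finset.sum_congr rfl fun b _ => ?_
  have : ∀ a, p a * (p b * if Y b a then 1 else 0) / classMass p Y a * F b =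
      (p a * if Y a b then 1 else 0) * (p b / classMass p Y b * F b) := by
    intro a
    by_cases h : Y a b
    · rw [if_pos h, if_pos (Y.symm h), classMass_congr Y h]
      ring
    · rw [if_neg h, if_neg fun k => h (Y.symm k)]
      ring
  rw [Finset.sum_congr rfl fun a _ => this a, ← Finset.sum_mul]
  change classMass p Y b * _ = _
  conv_rhs => rw [← mul_classMass_div_self hp Y b]
  ring

lemma fibreWeight_nonneg (hp : ∀ ω, 0 ≤ p ω) (Y : Setoid Ω) (z : FibreProd Y) :
    0 ≤ fibreWeight p Y z :=
  div_nonneg (mul_nonneg (hp _) (hp _)) (classMass_nonneg hp _ _)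

lemma classMass_fibreWeight {Y s t : Setoid Ω} (hs : s ≤ Y)
    (z : FibreProd Y) :
    classMass (fibreWeight p Y) (t.comap (fun z => z.1.2) ⊓ s.comap (fun z => z.1.1)) z =
      classMass p s z.1.1 * classMass p (t ⊓ Y) z.1.2 / classMass p Y z.1.1 := by
  classical
  have h := sum_fibreWeight (p := p) Y
    fun w => if t w.2 z.1.2 ∧ s w.1 z.1.1 then 1 else 0
  refine Eq.trans ?_ (h.trans ?_)
  · unfold classMass
    exact Finset.sum_congr rfl fun w _ => congrArg _ (if_congr Iff.rfl rfl rfl)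
  · unfold classMass
    rw [Finset.sum_mul, Finset.sum_div]
    refine Finset.sum_congr rfl fun a _ => ?_
    rw [Finset.mul_sum, Finset.sum_div]
    refine Finset.sum_congr rfl fun b _ => ?_
    by_cases hsa : s a z.1.1
    · have hY : Y a z.1.1 := hs hsa
      have hiff : Y b a ↔ Y b z.1.2 :=
        ⟨fun k => Y.trans k (Y.trans hY z.2), fun k => Y.trans k (Y.symm (Y.trans hY z.2))⟩
      have hm := classMass_congr (p := p) Y hY
      unfold classMass at hm
      rw [hm]
      by_cases h1 : t b z.1.2
      · by_cases h2 : Y b z.1.2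
        · rw [if_pos (hiff.2 h2), if_pos ⟨h1, hsa⟩, if_pos hsa,
            if_pos (show (t ⊓ Y) b z.1.2 from ⟨h1, h2⟩)]
          ring
        · rw [if_neg fun k => h2 (hiff.1 k), if_neg fun k : (t ⊓ Y) b z.1.2 => h2 k.2]
          ring
      · rw [if_neg fun k : t b z.1.2 ∧ _ => h1 k.1, if_neg fun k : (t ⊓ Y) b z.1.2 => h1 k.1]
        ring
    · rw [if_neg fun k : t b z.1.2 ∧ _ => hsa k.2, if_neg hsa]
      ring

lemma partEntropy_fibreWeight (hp : ∀ ω, 0 ≤ p ω) {Y s : Setoid Ω} (t : Setoid Ω)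
    (hs : s ≤ Y) :
    partEntropy (fibreWeight p Y) (t.comap (fun z => z.1.2) ⊓ s.comap (fun z => z.1.1)) =
      partEntropy p (t ⊓ Y) + partEntropy p s - partEntropy p Y := by
  have hterm : ∀ z : FibreProd Y, fibreWeight p Y z * Real.log (classMass (fibreWeight p Y)
      (t.comap (fun z => z.1.2) ⊓ s.comap (fun z => z.1.1)) z) =
      fibreWeight p Y z * Real.log (classMass p s z.1.1) +
      fibreWeight p Y z * Real.log (classMass p (t ⊓ Y) z.1.2) -
      fibreWeight p Y z * Real.log (classMass p Y z.1.1) := by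
    intro z
    rw [classMass_fibreWeight hs]
    rcases (hp z.1.1).eq_or_lt with h1 | h1
    · simp [fibreWeight, ← h1]
    rcases (hp z.1.2).eq_or_lt with h2 | h2
    · simp [fibreWeight, ← h2]
    have k1 := classMass_pos hp s h1
    have k2 := classMass_pos hp (t ⊓ Y) h2
    have k3 := classMass_pos hp Y h1
    rw [Real.log_div (mul_pos k1 k2).ne' k3.ne', Real.log_mul k1.ne' k2.ne']
    ring
  have h1 := sum_fibreWeight_fst hp Y fun ω => Real.log (classMass p s ω)
  have h2 := sum_fibreWeight_snd hp Y fun ω => Real.log (classMass p (t ⊓ Y) ω)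
  have h3 := sum_fibreWeight_fst hp Y fun ω => Real.log (classMass p Y ω)
  rw [partEntropy, Finset.sum_congr rfl fun z _ => hterm z, Finset.sum_sub_distrib,
    Finset.sum_add_distrib, h1, h2, h3]
  unfold partEntropy
  ring

/-- **Copy lemma.** Every `t` has a copy `t'` over `Y`: jointly with `Y` it is distributed
like `t`, and it is independent of everything else conditional on `Y`. -/
theorem exists_copy (hp : ∀ ω, 0 ≤ p ω) (t Y : Setoid Ω) :
    ∃ (Ω' : Type) (_ : Fintype Ω') (q : Ω' → ℝ) (φ : Ω' → Ω) (t' : Setoid Ω'),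
      (∀ ω, 0 ≤ q ω) ∧
      (∀ s : Setoid Ω, partEntropy q (s.comap φ) = partEntropy p s) ∧
      (∀ s : Setoid Ω, Y ≤ s → partEntropy q (t' ⊓ s.comap φ) = partEntropy p (t ⊓ s)) ∧
      (∀ s : Setoid Ω, s ≤ Y → partEntropy q (t' ⊓ s.comap φ) =
        partEntropy p (t ⊓ Y) + partEntropy p s - partEntropy p Y) := by
  refine ⟨FibreProd Y, inferInstance, fibreWeight p Y, fun z => z.1.1,
    t.comap fun z => z.1.2, fibreWeight_nonneg hp Y,
    partEntropy_comap (sum_fibreWeight_fst hp Y), fun s hs => ?_,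
    fun s hs => partEntropy_fibreWeight hp t hs⟩
  have hfib : s.comap (fun z : FibreProd Y => z.1.1) = s.comap fun z => z.1.2 := by
    ext z w
    exact ⟨fun k => s.trans (s.trans (s.symm (hs z.2)) k) (hs w.2),
      fun k => s.trans (s.trans (hs z.2) k) (s.symm (hs w.2))⟩
  rw [hfib]
  exact partEntropy_comap (sum_fibreWeight_snd hp Y) (t ⊓ s)

end Copy

section NonShannon

variable {Ω : Type} [Fintype Ω] {p : Ω → ℝ}

lemma comap_inf_comap {α β : Type} (f : α → β) (s t : Setoid β) :
    s.comap f ⊓ t.comap f = (s ⊓ t).comap f :=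
  rfl

lemma comap_top {α β : Type} (f : α → β) : (⊤ : Setoid β).comap f = ⊤ :=
  rfl

/-- A five-variable non-Shannon inequality of Makarychev, Makarychev, Romashchenko and
Vereshchagin. -/
theorem mutualInfo_le_five_variables (hp : ∀ ω, 0 ≤ p ω) (a b c d r : Setoid Ω) :
    mutualInfo p a b ≤ condMutualInfo p a b c + condMutualInfo p a b d + mutualInfo p c d +
      condMutualInfo p a c r + condMutualInfo p a r c + condMutualInfo p c r a := by
  obtain ⟨Ω', _, q, φ, s, hq, hφ, hcoarse, hfine⟩ := exists_copy hp r (a ⊓ c)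
  have e₁ := hcoarse a inf_le_left
  have e₂ := hcoarse c inf_le_right
  have e₃ := hcoarse ⊤ le_top
  have e₄ := hfine (a ⊓ b ⊓ c) (inf_le_inf_right c inf_le_left)
  have e₅ := hfine (a ⊓ c ⊓ d) inf_le_left
  have e₆ := hfine (a ⊓ b ⊓ c ⊓ d) (inf_le_left.trans (inf_le_inf_right c inf_le_left))
  have f₁ := hφ a
  have f₂ := hφ b
  have f₃ := hφ c
  have f₄ := hφ (a ⊓ b)
  have f₅ := hφ (a ⊓ d)
  have f₆ := hφ (b ⊓ c)
  have f₇ := hφ (b ⊓ d)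
  have f₈ := hφ (c ⊓ d)
  have f₉ := hφ (a ⊓ b ⊓ d)
  have f₁₀ := hφ (a ⊓ c ⊓ d)
  have f₁₁ := hφ (a ⊓ b ⊓ c ⊓ d)
  simp only [← comap_inf_comap, comap_top, inf_top_eq]
    at e₁ e₂ e₃ e₄ e₅ e₆ f₁ f₂ f₃ f₄ f₅ f₆ f₇ f₈ f₉ f₁₀ f₁₁
  generalize a.comap φ = a' at *
  generalize b.comap φ = b' at *
  generalize c.comap φ = c' at *
  generalize d.comap φ = d' at *
  have g₁ := condMutualInfo_nonneg hq d' s a'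
  have g₂ := condMutualInfo_nonneg hq d' s b'
  have g₃ := condMutualInfo_nonneg hq b' s a'
  have g₄ := condMutualInfo_nonneg hq b' s c'
  have g₅ := condMutualInfo_nonneg hq c' s (a' ⊓ b' ⊓ d')
  have g₆ := condMutualInfo_nonneg hq a' b' (d' ⊓ s)
  have g₇ := condMutualInfo_nonneg hq a' c' (b' ⊓ s)
  have g₈ := condMutualInfo_nonneg hq c' d' s
  have g₉ := condMutualInfo_nonneg hq a' s (c' ⊓ d')
  simp only [condMutualInfo, mutualInfo, inf_comm, inf_left_comm] at *
  linarith

/-- A four-variable non-Shannon inequality of Dougherty, Freiling and Zeger. -/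
theorem two_mul_mutualInfo_le (hp : ∀ ω, 0 ≤ p ω) (a b c d : Setoid Ω) :
    2 * mutualInfo p a b ≤ 5 * condMutualInfo p a b c + 3 * condMutualInfo p a c b +
      condMutualInfo p b c a + 2 * condMutualInfo p a b d + 2 * mutualInfo p c d := by
  obtain ⟨Ω', _, q, φ, r, hq, hφ, hcoarse, hfine⟩ := exists_copy hp c (a ⊓ b)
  have e₁ := hcoarse a inf_le_left
  have e₂ := hcoarse b inf_le_right
  have e₃ := hcoarse ⊤ le_top
  have e₄ := hfine (a ⊓ b ⊓ c) inf_le_left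
  have e₅ := hfine (a ⊓ b ⊓ d) inf_le_left
  have e₆ := hfine (a ⊓ b ⊓ c ⊓ d) (inf_le_left.trans inf_le_left)
  have f₁ := hφ a
  have f₂ := hφ b
  have f₃ := hφ c
  have f₄ := hφ (a ⊓ b)
  have f₅ := hφ (a ⊓ c)
  have f₆ := hφ (a ⊓ d)
  have f₇ := hφ (b ⊓ c)
  have f₈ := hφ (b ⊓ d)
  have f₉ := hφ (c ⊓ d)
  have f₁₀ := hφ (a ⊓ b ⊓ d)
  have f₁₁ := hφ (a ⊓ c ⊓ d)
  have f₁₂ := hφ (a ⊓ b ⊓ c)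
  have f₁₃ := hφ (a ⊓ b ⊓ c ⊓ d)
  have f₁₄ := hφ d
  simp only [← comap_inf_comap, comap_top, inf_top_eq]
    at e₁ e₂ e₃ e₄ e₅ e₆ f₁ f₂ f₃ f₄ f₅ f₆ f₇ f₈ f₉ f₁₀ f₁₁ f₁₂ f₁₃ f₁₄
  generalize a.comap φ = a' at *
  generalize b.comap φ = b' at *
  generalize c.comap φ = c' at *
  generalize d.comap φ = d' at *
  have g₁ := mutualInfo_le_five_variables hq a' b' c' d' r
  have g₂ := condMutualInfo_nonneg hq a' b' (d' ⊓ r)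
  have g₃ := condMutualInfo_nonneg hq c' r b'
  have g₄ := condMutualInfo_nonneg hq a' b' (c' ⊓ r)
  have g₅ := condMutualInfo_nonneg hq b' r (a' ⊓ c' ⊓ d')
  have g₆ := condMutualInfo_nonneg hq c' d' r
  have g₇ := condMutualInfo_nonneg hq d' r b'
  have g₈ := condMutualInfo_nonneg hq d' r a'
  have g₉ := condMutualInfo_nonneg hq a' r (c' ⊓ d')
  simp only [condMutualInfo, mutualInfo, inf_comm, inf_left_comm] at *
  linarith

end NonShannon

section SchemeModel

lemma finsetInf_setoid_apply {ι α : Type} (v : ι → Setoid α) (X : Finset ι) (t u : α) :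
    X.inf v t u ↔ ∀ i ∈ X, v i t u := by
  classical
  induction X using Finset.induction_on with
  | empty => exact iff_of_true trivial (by simp)
  | insert i X _ ih =>
    rw [Finset.inf_insert, Finset.forall_mem_insert, ← ih]
    exact Iff.rfl

/-- The joint entropy of finite-valued random variables as a partition entropy. -/
lemma shannonEntropy_eq_partEntropy {Ω : Type} [MeasurableSpace Ω] {μ : Measure Ω}
    [IsProbabilityMeasure μ] {T : Type} [Fintype T] (J : Ω → T)
    (hJ : ∀ t, MeasurableSet (J ⁻¹' {t})) {α : Type} [Fintype α] (g : T → α) :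
    shannonEntropy μ (fun ω => g (J ω)) =
      partEntropy (fun t => (μ (J ⁻¹' {t})).toReal) (Setoid.ker g) := by
  classical
  set p : T → ℝ := fun t => (μ (J ⁻¹' {t})).toReal with hp
  have hmass : ∀ a : α, (μ ((fun ω => g (J ω)) ⁻¹' {a})).toReal =
      ∑ t ∈ Finset.univ.filter (fun t => g t = a), p t := by
    intro a
    have hset : (fun ω => g (J ω)) ⁻¹' {a} =
        ⋃ t ∈ Finset.univ.filter (fun t => g t = a), J ⁻¹' {t} := by
      ext ω
      simp
    rw [hset]
    refine measureReal_biUnion_finset (μ := μ) (fun s _ t _ hst => ?_) fun t _ => hJ t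
    exact Disjoint.preimage J (Set.disjoint_singleton.2 hst)
  have hclass : ∀ t, classMass p (Setoid.ker g) t =
      ∑ t' ∈ Finset.univ.filter (fun t' => g t' = g t), p t' := by
    intro t
    rw [Finset.sum_filter]
    refine Finset.sum_congr rfl fun t' _ => ?_
    by_cases h : g t' = g t
    · rw [if_pos h, if_pos (show Setoid.ker g t' t from h), mul_one]
    · rw [if_neg h, if_neg (show ¬ Setoid.ker g t' t from h), mul_zero]
  simp only [shannonEntropy, Real.negMulLog, hmass, partEntropy, hclass]
  rw [← Finset.sum_fiberwise (s := Finset.univ) (g := g), ← Finset.sum_neg_distrib]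
  refine Finset.sum_congr rfl fun a _ => ?_
  rw [neg_mul, Finset.sum_mul]
  congr 1
  refine Finset.sum_congr rfl fun t ht => ?_
  rw [(Finset.mem_filter.1 ht).2]

/-- The joint entropies of a scheme are those of partitions of a finite probability space. -/
theorem Scheme.exists_partEntropy {P : Type} [Fintype P] [DecidableEq P] (S : Scheme P) :
    ∃ (T : Type) (_ : Fintype T) (p : T → ℝ) (v : P → Setoid T) (s : Setoid T),
      (∀ t, 0 ≤ p t) ∧ ∑ t, p t = 1 ∧ S.Hsec = partEntropy p s ∧
      (∀ X, S.Hset X = partEntropy p (X.inf v)) ∧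
      (∀ X, S.HsetS X = partEntropy p (X.inf v ⊓ s)) := by
  let := S.mΩ
  let := S.secFin
  let := S.shFin
  have := S.prob
  let J : S.Ω → (∀ i, S.ShT i) × S.SecT := fun ω => (fun i => S.share i ω, S.secret ω)
  have hJ : ∀ t, MeasurableSet (J ⁻¹' {t}) := by
    intro t
    have : J ⁻¹' {t} = (⋂ i, S.share i ⁻¹' {t.1 i}) ∩ S.secret ⁻¹' {t.2} := by
      ext ω
      simp [J, Prod.ext_iff, funext_iff]
    rw [this]
    exact (MeasurableSet.iInter fun i => S.share_meas i _).inter (S.secret_meas _)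
  have hinf : ∀ X : Finset P,
      X.inf (fun i => Setoid.ker fun t : (∀ i, S.ShT i) × S.SecT => t.1 i) =
      Setoid.ker fun t : (∀ i, S.ShT i) × S.SecT => fun i : {y // y ∈ X} => t.1 i.1 := by
    intro X
    ext t u
    rw [finsetInf_setoid_apply]
    simp [Setoid.ker_def, funext_iff]
  refine ⟨(∀ i, S.ShT i) × S.SecT, inferInstance, fun t => (S.μ (J ⁻¹' {t})).toReal,
    fun i => Setoid.ker fun t => t.1 i, Setoid.ker Prod.snd, fun t => ENNReal.toReal_nonneg, ?_,
    shannonEntropy_eq_partEntropy J hJ Prod.snd, fun X => ?_, fun X => ?_⟩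
  · have h := measureReal_biUnion_finset (μ := S.μ) (s := Finset.univ) (f := fun t => J ⁻¹' {t})
      (fun s _ t _ hst => Disjoint.preimage J (Set.disjoint_singleton.2 hst)) fun t _ => hJ t
    refine h.symm.trans ?_
    have : ⋃ t ∈ (Finset.univ : Finset ((∀ i, S.ShT i) × S.SecT)), J ⁻¹' {t} = Set.univ := by
      ext ω
      simp
    rw [this]
    simp
  · rw [hinf]
    exact shannonEntropy_eq_partEntropy J hJ fun t => fun i : {y // y ∈ X} => t.1 i.1
  · rw [hinf]
    refine (shannonEntropy_eq_partEntropy J hJ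
      fun t => ((fun i : {y // y ∈ X} => t.1 i.1), t.2)).trans (congrArg _ ?_)
    ext t u
    exact Prod.ext_iff

end SchemeModel

section Vamos

lemma mem_vamosQualified {M Y : Finset (Fin 8)} (hM : M ⊆ Y) (h5 : 5 ∉ M)
    (h : VamosCircuit (insert 5 M)) : VamosQualified 5 Y :=
  Or.inr ⟨M, hM, h5, h⟩

instance : DecidablePred VamosDep := fun X => by
  unfold VamosDep
  infer_instance

lemma vamosCircuit_of_card_le {X : Finset (Fin 8)} (hX : VamosDep X) (h5 : X.card ≤ 5)
    (h : ¬ (pairA ∪ pairB ⊂ X ∨ pairA ∪ pairC ⊂ X ∨ pairB ∪ pairC ⊂ X ∨ pairB ∪ pairD ⊂ X ∨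
      pairC ∪ pairD ⊂ X)) : VamosCircuit X := by
  refine ⟨hX, fun Y hY hd => ?_⟩
  have hlt := Finset.card_lt_card hY
  rcases hd with rfl | rfl | rfl | rfl | rfl | hc
  · exact h (.inl hY)
  · exact h (.inr (.inl hY))
  · exact h (.inr (.inr (.inl hY)))
  · exact h (.inr (.inr (.inr (.inl hY))))
  · exact h (.inr (.inr (.inr (.inr hY))))
  · omega

lemma not_vamosQualified {Y : Finset (Fin 8)} (h5 : 5 ∉ Y)
    (h : ¬ (pairA ∪ pairC ⊆ insert 5 Y ∨ pairB ∪ pairC ⊆ insert 5 Y ∨ pairC ∪ pairD ⊆ insert 5 Y))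
    (hY : Y.card ≤ 3 ∨ Y = pairA ∪ pairB ∨ Y = pairB ∪ pairD) : ¬ VamosQualified 5 Y := by
  rintro (h' | ⟨M, hM, hM5, hdep, hmin⟩)
  · exact h5 h'
  have hMY : insert 5 M ⊆ insert 5 Y := Finset.insert_subset_insert 5 hM
  have hmem : 5 ∈ insert 5 M := Finset.mem_insert_self 5 M
  rcases hdep with hd | hd | hd | hd | hd | hc
  · rw [hd] at hmem
    exact absurd hmem (by decide)
  · exact h (.inl (hd ▸ hMY))
  · exact h (.inr (.inl (hd ▸ hMY)))
  · rw [hd] at hmem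
    exact absurd hmem (by decide)
  · exact h (.inr (.inr (hd ▸ hMY)))
  · rw [Finset.card_insert_of_notMem hM5] at hc
    have hle := Finset.card_le_card hM
    rcases hY with hY | rfl | rfl
    · omega
    · obtain rfl := Finset.eq_of_subset_of_card_le hM (by simp [pairA, pairB]; omega)
      exact hmin _ (Finset.ssubset_insert hM5) (.inl rfl)
    · obtain rfl := Finset.eq_of_subset_of_card_le hM (by simp [pairB, pairD]; omega)
      exact hmin _ (Finset.ssubset_insert hM5) (.inr (.inr (.inr (.inl rfl))))

/-- Shares of a perfect scheme for `V₆`, as partitions: a weighted sum of their entropies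
exceeds that of the secret by the required factor. -/
theorem le_sum_partEntropy {T : Type} [Fintype T] {p : T → ℝ} (hp : ∀ t, 0 ≤ p t)
    (h1 : ∑ t, p t = 1) (v₁ v₂ v₃ v₄ v₅ v₇ v₈ s : Setoid T)
    (q₁₂₅ : partEntropy p (v₁ ⊓ v₂ ⊓ v₅ ⊓ s) = partEntropy p (v₁ ⊓ v₂ ⊓ v₅))
    (q₃₄₅ : partEntropy p (v₃ ⊓ v₄ ⊓ v₅ ⊓ s) = partEntropy p (v₃ ⊓ v₄ ⊓ v₅))
    (q₅₇₈ : partEntropy p (v₅ ⊓ v₇ ⊓ v₈ ⊓ s) = partEntropy p (v₅ ⊓ v₇ ⊓ v₈))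
    (q₁₂₇₈ : partEntropy p (v₁ ⊓ v₂ ⊓ v₇ ⊓ v₈ ⊓ s) = partEntropy p (v₁ ⊓ v₂ ⊓ v₇ ⊓ v₈))
    (q₁₂₃₄₇ : partEntropy p (v₁ ⊓ v₂ ⊓ v₃ ⊓ v₄ ⊓ v₇ ⊓ s) =
      partEntropy p (v₁ ⊓ v₂ ⊓ v₃ ⊓ v₄ ⊓ v₇))
    (u₅ : partEntropy p (v₅ ⊓ s) = partEntropy p v₅ + partEntropy p s)
    (u₁₂₇ : partEntropy p (v₁ ⊓ v₂ ⊓ v₇ ⊓ s) = partEntropy p (v₁ ⊓ v₂ ⊓ v₇) + partEntropy p s)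
    (u₁₂₃₄ : partEntropy p (v₁ ⊓ v₂ ⊓ v₃ ⊓ v₄ ⊓ s) =
      partEntropy p (v₁ ⊓ v₂ ⊓ v₃ ⊓ v₄) + partEntropy p s)
    (u₃₄₇₈ : partEntropy p (v₃ ⊓ v₄ ⊓ v₇ ⊓ v₈ ⊓ s) =
      partEntropy p (v₃ ⊓ v₄ ⊓ v₇ ⊓ v₈) + partEntropy p s) :
    19 * partEntropy p s ≤ partEntropy p v₃ + partEntropy p v₄ + 11 * partEntropy p v₅ +
      2 * partEntropy p v₇ + 2 * partEntropy p v₈ := by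
  have g₁ := two_mul_mutualInfo_le hp (v₅ ⊓ s) (v₃ ⊓ v₄) (v₁ ⊓ v₂) (v₇ ⊓ v₈)
  have g₂ := partEntropy_mono hp (inf_le_left : v₃ ⊓ v₄ ⊓ v₇ ⊓ v₈ ⊓ s ⊓ v₅ ≤ _)
  have g₃ := partEntropy_mono hp (inf_le_left : v₁ ⊓ v₂ ⊓ v₃ ⊓ v₄ ⊓ s ⊓ v₅ ≤ _)
  have g₄ := partEntropy_mono hp (inf_le_left : v₁ ⊓ v₂ ⊓ v₇ ⊓ s ⊓ (v₃ ⊓ v₄) ≤ _)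
  have g₅ := partEntropy_mono hp (inf_le_left : v₁ ⊓ v₂ ⊓ v₃ ⊓ v₄ ⊓ s ⊓ (v₇ ⊓ v₈) ≤ _)
  have g₆ := mutualInfo_nonneg hp h1 v₇ v₈
  have g₇ := mutualInfo_nonneg hp h1 v₃ v₅
  have g₈ := mutualInfo_nonneg hp h1 v₄ (v₃ ⊓ v₅)
  have g₉ := mutualInfo_nonneg hp h1 (v₁ ⊓ v₂) v₅
  have g₁₀ := mutualInfo_nonneg hp h1 (v₃ ⊓ v₄) v₅
  have g₁₁ := mutualInfo_nonneg hp h1 v₅ (v₇ ⊓ v₈)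
  have g₁₂ := condMutualInfo_nonneg hp (v₃ ⊓ v₄) v₇ (v₁ ⊓ v₂)
  have g₁₃ := condMutualInfo_nonneg hp (v₃ ⊓ v₄) v₈ (v₁ ⊓ v₂ ⊓ v₇ ⊓ s)
  simp only [condMutualInfo, mutualInfo, inf_comm, inf_left_comm] at *
  linarith

theorem Scheme.le_sum_Hset_of_isPerfect {S : Scheme (Fin 8)}
    (hS : S.IsPerfect (VamosQualified 5)) :
    19 * S.Hsec ≤ S.Hset {2} + S.Hset {3} + 11 * S.Hset {4} + 2 * S.Hset {6} + 2 * S.Hset {7} := by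
  obtain ⟨T, _, p, v, s, hp, h1, hs, hv, hvs⟩ := S.exists_partEntropy
  have hq : ∀ X, VamosQualified 5 X → partEntropy p (X.inf v ⊓ s) = partEntropy p (X.inf v) :=
    fun X hX => by rw [← hv, ← hvs]; linarith [hS.1 X hX]
  have hu : ∀ X, ¬ VamosQualified 5 X →
      partEntropy p (X.inf v ⊓ s) = partEntropy p (X.inf v) + partEntropy p s :=
    fun X hX => by rw [← hv, ← hvs, ← hs]; linarith [hS.2 X hX]
  have c₁₂₅ : VamosCircuit (insert 5 {0, 1, 4}) :=
    vamosCircuit_of_card_le (by decide) (by decide) (by decide)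
  have c₃₄₅ : VamosCircuit (insert 5 {2, 3, 4}) :=
    vamosCircuit_of_card_le (by decide) (by decide) (by decide)
  have c₅₇₈ : VamosCircuit (insert 5 {4, 6, 7}) :=
    vamosCircuit_of_card_le (by decide) (by decide) (by decide)
  have c₁₂₇₈ : VamosCircuit (insert 5 {0, 1, 6, 7}) :=
    vamosCircuit_of_card_le (by decide) (by decide) (by decide)
  have c₁₂₃₇ : VamosCircuit (insert 5 {0, 1, 2, 6}) :=
    vamosCircuit_of_card_le (by decide) (by decide) (by decide)
  have q₁₂₅ := hq {0, 1, 4} (mem_vamosQualified subset_rfl (by decide) c₁₂₅)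
  have q₃₄₅ := hq {2, 3, 4} (mem_vamosQualified subset_rfl (by decide) c₃₄₅)
  have q₅₇₈ := hq {4, 6, 7} (mem_vamosQualified subset_rfl (by decide) c₅₇₈)
  have q₁₂₇₈ := hq {0, 1, 6, 7} (mem_vamosQualified subset_rfl (by decide) c₁₂₇₈)
  have q₁₂₃₄₇ := hq {0, 1, 2, 3, 6} (mem_vamosQualified (by decide) (by decide) c₁₂₃₇)
  have u₅ := hu {4} (not_vamosQualified (by decide) (by decide) (by decide))
  have u₁₂₇ := hu {0, 1, 6} (not_vamosQualified (by decide) (by decide) (by decide))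
  have u₁₂₃₄ := hu {0, 1, 2, 3} (not_vamosQualified (by decide) (by decide) (by decide))
  have u₃₄₇₈ := hu {2, 3, 6, 7} (not_vamosQualified (by decide) (by decide) (by decide))
  simp only [hs, hv]
  simp only [Finset.inf_insert, Finset.inf_singleton, ← inf_assoc] at *
  exact le_sum_partEntropy hp h1 _ _ _ _ _ _ _ s q₁₂₅ q₃₄₅ q₅₇₈ q₁₂₇₈ q₁₂₃₄₇ u₅ u₁₂₇ u₁₂₃₄ u₃₄₇₈

theorem Scheme.rho_le_of_isPerfect {S : Scheme (Fin 8)} (hS : S.IsPerfect (VamosQualified 5))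
    (h0 : 0 < S.Hsec) : S.rho ≤ 17 / 19 := by
  by_contra! h
  have hlt : ∀ i, 17 * S.Hset {i} < 19 * S.Hsec := by
    intro i
    have hi : 17 / 19 < S.Hsec / S.Hset {i} :=
      h.trans_le (Finset.inf'_le _ (Finset.mem_univ i))
    rcases le_or_gt (S.Hset {i}) 0 with hn | hpos
    · linarith
    · rw [div_lt_div_iff₀ (by norm_num) hpos] at hi
      linarith
  linarith [Scheme.le_sum_Hset_of_isPerfect hS, hlt 2, hlt 3, hlt 4, hlt 6, hlt 7]

end Vamos

/-- Every perfect secret sharing scheme for `V₆ = Γ_{v₆}` (dealer `v₆`, i.e. `(5 : Fin 8)`)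
has information rate `ρ(Σ) ≤ 17/19`; consequently
`ρ(V₆) = sup {ρ(Σ) | Σ a perfect scheme for V₆} ≤ 17/19`. -/
theorem V6_rate_le :
    (∀ S : Scheme (Fin 8),
        S.IsPerfect (VamosQualified 5) → 0 < S.Hsec → S.rho ≤ 17 / 19) ∧
    sSup {r : ℝ | ∃ S : Scheme (Fin 8),
        S.IsPerfect (VamosQualified 5) ∧ 0 < S.Hsec ∧ S.rho = r} ≤ 17 / 19 := by
  refine ⟨fun S hS h0 => Scheme.rho_le_of_isPerfect hS h0, ?_⟩
  refine Real.sSup_le ?_ (by norm_num)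
  rintro r ⟨S, hS, h0, rfl⟩
  exact Scheme.rho_le_of_isPerfect hS h0
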